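/- Every g ∈ C_c^∞((0,1)^d) admits a decomposition g = Σ_{k∈ℤ^d} g_k * h_k on (0,1)^d, where h_k(x) = e^{2πi k·x}χ_{(0,1/2)^d}(x), g_k = a_k h_k, and (a_k)_{k∈ℤ^d} are the Fourier coefficients of g/Λ with Σ_k |a_k| < ∞; in particular Σ_k ‖g_k‖_{L²((0,1/2)^d)} ‖h_k‖_{L²((0,1/2)^d)} < ∞. Here Λ(x) = ∏_{i=1}^d λ(x_i) with λ(t) = 1/2 − |t−1/2|. -/

import Mathlib

open MeasureTheory Complex Set
open scoped ENNReal Real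

noncomputable section

abbrev Ed (d : ℕ) := EuclideanSpace ℝ (Fin d)

def IsTestFun {d : ℕ} (Ω : Set (Ed d)) (φ : Ed d → ℂ) : Prop :=
  ContDiff ℝ (⊤ : ℕ∞) φ ∧ HasCompactSupport φ ∧ tsupport φ ⊆ Ω

def lamTent (t : ℝ) : ℝ := 1 / 2 - |t - 1 / 2|

def LamTent {d : ℕ} (x : Ed d) : ℝ := ∏ i, lamTent (x i)

def hFun {d : ℕ} (k : Fin d → ℤ) (x : Ed d) : ℂ :=
  Complex.exp (2 * π * Complex.I * (∑ i, (k i : ℂ) * (x i : ℂ))) *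
    Set.indicator {y : Ed d | ∀ i, 0 < y i ∧ y i < 1 / 2} (fun _ => (1 : ℂ)) x

open Filter Topology UnitAddTorus

/-- The open unit cube. -/
def unitCube (d : ℕ) : Set (Ed d) := {x | ∀ i, 0 < x i ∧ x i < 1}

/-- The character `x ↦ exp (2πi k·x)`. -/
def expChar {d : ℕ} (k : Fin d → ℤ) (x : Ed d) : ℂ :=
  Complex.exp (2 * π * Complex.I * (∑ i, (k i : ℂ) * (x i : ℂ)))

/-- `F` is represented on the open unit cube by an absolutely convergent trigonometric series,
with frequencies possibly repeated. -/
def HasAbsConvFourier {d : ℕ} (F : Ed d → ℂ) : Prop :=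
  ∃ (ι : Type) (b : ι → ℂ) (κ : ι → Fin d → ℤ), Summable (fun i => ‖b i‖) ∧
    ∀ x ∈ unitCube d, HasSum (fun i => b i * expChar (κ i) x) (F x)

section Characters

variable {d : ℕ}

lemma expChar_zero (x : Ed d) : expChar 0 x = 1 := by simp [expChar]

lemma expChar_add (k l : Fin d → ℤ) (x : Ed d) :
    expChar (k + l) x = expChar k x * expChar l x := by
  simp only [expChar, ← Complex.exp_add, ← mul_add, ← Finset.sum_add_distrib]
  congr 2
  exact Finset.sum_congr rfl fun i _ => by push_cast [Pi.add_apply]; ring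

lemma expChar_neg (k : Fin d → ℤ) (x : Ed d) :
    expChar (-k) x = Complex.exp (-(2 * π * Complex.I) * (∑ i, (k i : ℂ) * (x i : ℂ))) := by
  simp [expChar, Finset.sum_neg_distrib]

lemma expChar_add_right (k : Fin d → ℤ) (x y : Ed d) :
    expChar k (x + y) = expChar k x * expChar k y := by
  simp only [expChar, ← Complex.exp_add, ← mul_add, ← Finset.sum_add_distrib]
  simp [mul_add]

lemma norm_expChar (k : Fin d → ℤ) (x : Ed d) : ‖expChar k x‖ = 1 := by
  have : 2 * π * Complex.I * (∑ i, (k i : ℂ) * (x i : ℂ)) =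
      ((2 * π * ∑ i, (k i : ℝ) * x i : ℝ) : ℂ) * Complex.I := by
    push_cast; ring
  rw [expChar, this, Complex.norm_exp_ofReal_mul_I]

@[fun_prop]
lemma continuous_expChar (k : Fin d → ℤ) : Continuous (expChar k) := by
  unfold expChar; fun_prop

lemma expChar_eq_prod_fourier (k : Fin d → ℤ) (x : Ed d) :
    expChar k x = ∏ i, fourier (k i) (x i : UnitAddCircle) := by
  simp only [expChar, fourier_coe_apply, ← Complex.exp_sum, Finset.mul_sum]
  congr 1
  exact Finset.sum_congr rfl fun i _ => by push_cast; ring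

lemma mFourier_coe (k : Fin d → ℤ) (x : Ed d) :
    mFourier k (fun i => (x i : UnitAddCircle)) = expChar k x :=
  (expChar_eq_prod_fourier k x).symm

lemma expChar_single (j : Fin d) (n : ℤ) (x : Ed d) :
    expChar (Pi.single j n) x = fourier n (x j : UnitAddCircle) := by
  rw [expChar_eq_prod_fourier, Finset.prod_eq_single j]
  · simp
  · intro i _ hi; simp [Pi.single_eq_of_ne hi]
  · simp

lemma integral_Ioo_fourier (n : ℤ) :
    ∫ t in Ioo (0 : ℝ) 1, fourier n (t : UnitAddCircle) = if n = 0 then 1 else 0 := by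
  rw [← integral_Ioc_eq_integral_Ioo, ← intervalIntegral.integral_of_le zero_le_one]
  split_ifs with h
  · simp [h]
  · have hc : (2 * π * Complex.I * n : ℂ) ≠ 0 := by
      simp [h, Real.pi_ne_zero]
    have : ∀ t : ℝ, fourier n (t : UnitAddCircle) = Complex.exp (2 * π * Complex.I * n * t) := by
      intro t; rw [fourier_coe_apply]; simp
    simp_rw [this]
    rw [integral_exp_mul_complex hc]
    have := Complex.exp_int_mul_two_pi_mul_I n
    rw [show (2 * π * Complex.I * n * (1 : ℝ) : ℂ) = n * (2 * π * Complex.I) by push_cast; ring,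
      this]
    simp

lemma measurableSet_unitCube : MeasurableSet (unitCube d) := by
  have : unitCube d = ⋂ i, {x : Ed d | 0 < x i ∧ x i < 1} := by
    ext x; simp [unitCube]
  rw [this]
  refine MeasurableSet.iInter fun i => ?_
  exact (measurableSet_Ioo (a := (0:ℝ)) (b := 1)).preimage
    (by fun_prop : Measurable fun x : Ed d => x i)

/-- Integration of a product function over a box in Euclidean space. -/
lemma setIntegral_box_prod (s : Fin d → Set ℝ) (f : Fin d → ℝ → ℂ) :
    ∫ x in {x : Ed d | ∀ i, x i ∈ s i}, ∏ i, f i (x i) = ∏ i, ∫ t in s i, f i t := by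
  have h := (PiLp.volume_preserving_ofLp (Fin d)).setIntegral_preimage_emb
    (MeasurableEquiv.toLp 2 (Fin d → ℝ)).symm.measurableEmbedding
    (fun y => ∏ i, f i (y i)) (Set.univ.pi s)
  rw [volume_pi, Measure.restrict_pi_pi, integral_fintype_prod_eq_prod] at h
  rw [← h]
  congr 2
  ext x; simp

lemma integral_unitCube_expChar (k : Fin d → ℤ) :
    ∫ x in unitCube d, expChar k x = if k = 0 then 1 else 0 := by
  simp_rw [expChar_eq_prod_fourier]
  rw [show unitCube d = {x : Ed d | ∀ i, x i ∈ Ioo (0 : ℝ) 1} from rfl,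
    setIntegral_box_prod (fun _ => Ioo 0 1) (fun i t => fourier (k i) (t : UnitAddCircle))]
  simp_rw [integral_Ioo_fourier]
  simp [Finset.prod_ite_zero, funext_iff]

lemma volume_unitCube_lt_top : volume (unitCube d) < ⊤ := by
  refine lt_top_iff_ne_top.2 fun h => ?_
  have := integral_unitCube_expChar (0 : Fin d → ℤ)
  simp [expChar_zero, Measure.real, h] at this

end Characters

namespace HasAbsConvFourier

variable {d : ℕ} {F G : Ed d → ℂ}

lemma congr (hF : HasAbsConvFourier F) (h : ∀ x ∈ unitCube d, G x = F x) :
    HasAbsConvFourier G := by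
  obtain ⟨ι, b, κ, hb, hs⟩ := hF
  exact ⟨ι, b, κ, hb, fun x hx => by rw [h x hx]; exact hs x hx⟩

lemma const (c : ℂ) : HasAbsConvFourier (fun _ : Ed d => c) :=
  ⟨Unit, fun _ => c, fun _ => 0, (hasSum_fintype _).summable, fun x _ => by
    simp [expChar_zero]⟩

lemma add (hF : HasAbsConvFourier F) (hG : HasAbsConvFourier G) :
    HasAbsConvFourier (fun x => F x + G x) := by
  obtain ⟨ι, b, κ, hb, hs⟩ := hF
  obtain ⟨ι', b', κ', hb', hs'⟩ := hG
  refine ⟨ι ⊕ ι', Sum.elim b b', Sum.elim κ κ', ?_, fun x hx => ?_⟩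
  · exact (HasSum.sum (f := fun i => ‖Sum.elim b b' i‖) hb.hasSum hb'.hasSum).summable
  · exact HasSum.sum (f := fun i => Sum.elim b b' i * expChar (Sum.elim κ κ' i) x)
      (hs x hx) (hs' x hx)

lemma mul (hF : HasAbsConvFourier F) (hG : HasAbsConvFourier G) :
    HasAbsConvFourier (fun x => F x * G x) := by
  obtain ⟨ι, b, κ, hb, hs⟩ := hF
  obtain ⟨ι', b', κ', hb', hs'⟩ := hG
  refine ⟨ι × ι', fun p => b p.1 * b' p.2, fun p => κ p.1 + κ' p.2, ?_, fun x hx => ?_⟩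
  · have h : Summable fun p : ι × ι' => ‖b p.1‖ * ‖b' p.2‖ :=
      hb.mul_of_nonneg hb' (fun _ => norm_nonneg _) (fun _ => norm_nonneg _)
    exact h.congr fun p => (norm_mul _ _).symm
  · have h1 : Summable fun i => ‖b i * expChar (κ i) x‖ := by simpa [norm_expChar] using hb
    have h2 : Summable fun i => ‖b' i * expChar (κ' i) x‖ := by simpa [norm_expChar] using hb'
    have h3 : Summable fun p : ι × ι' =>
        (b p.1 * expChar (κ p.1) x) * (b' p.2 * expChar (κ' p.2) x) :=
      summable_mul_of_summable_norm (f := fun i => b i * expChar (κ i) x)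
        (g := fun i => b' i * expChar (κ' i) x) h1 h2
    have h4 := HasSum.mul (f := fun i => b i * expChar (κ i) x)
        (g := fun i => b' i * expChar (κ' i) x) (hs x hx) (hs' x hx) h3
    refine h4.congr_fun fun p => ?_
    rw [expChar_add]; ring

lemma prod {α : Type*} (s : Finset α) {f : α → Ed d → ℂ}
    (hf : ∀ j ∈ s, HasAbsConvFourier (f j)) : HasAbsConvFourier (fun x => ∏ j ∈ s, f j x) := by
  classical
  induction s using Finset.induction_on with
  | empty => simpa using const 1
  | insert j s hj ih =>
    simp_rw [Finset.prod_insert hj]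
    exact (hf j (by simp)).mul (ih fun i hi => hf i (by simp [hi]))

/-- Repeated frequencies can be collected. -/
lemma exists_coeff (hF : HasAbsConvFourier F) :
    ∃ a : (Fin d → ℤ) → ℂ, Summable (fun k => ‖a k‖) ∧
      ∀ x ∈ unitCube d, HasSum (fun k => a k * expChar k x) (F x) := by
  obtain ⟨ι, b, κ, hb, hs⟩ := hF
  let e := Equiv.sigmaFiberEquiv κ
  have hbe : Summable fun p => ‖b (e p)‖ := e.summable_iff.2 hb
  refine ⟨fun k => ∑' i : {i // κ i = k}, b i, ?_, fun x hx => ?_⟩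
  · refine .of_nonneg_of_le (fun _ => norm_nonneg _) (fun k => ?_) hbe.sigma
    exact norm_tsum_le_tsum_norm (hbe.sigma_factor k)
  · refine (e.hasSum_iff.2 (hs x hx)).sigma fun k => ?_
    have h : HasSum (fun i : {i // κ i = k} => b i) (∑' i : {i // κ i = k}, b i) :=
      (Summable.of_norm (hbe.sigma_factor k)).hasSum
    refine (h.mul_right (expChar k x)).congr_fun fun i => ?_
    simp [e, Equiv.sigmaFiberEquiv, i.2]

end HasAbsConvFourier

/-- The coefficients of an absolutely convergent trigonometric series on the unit cube are the
Fourier coefficients of its sum. -/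
lemma coeff_eq_integral {d : ℕ} {F : Ed d → ℂ} {a : (Fin d → ℤ) → ℂ}
    (ha : Summable fun k => ‖a k‖)
    (hF : ∀ x ∈ unitCube d, HasSum (fun k => a k * expChar k x) (F x)) (k : Fin d → ℤ) :
    a k = ∫ x in unitCube d, F x * expChar (-k) x := by
  have h_integrable (l m : Fin d → ℤ) :
      Integrable (fun x => a l * expChar m x) (volume.restrict (unitCube d)) := by
    have : IsFiniteMeasure (volume.restrict (unitCube d)) :=
      ⟨by simpa using volume_unitCube_lt_top⟩
    refine Integrable.of_bound (by fun_prop) ‖a l‖ (.of_forall fun x => ?_)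
    simp [norm_expChar]
  have h := hasSum_integral_of_summable_integral_norm
    (μ := volume.restrict (unitCube d)) (F := fun l x => a l * expChar (l - k) x)
    (fun l => h_integrable l _) (by simpa [norm_expChar] using ha.mul_left _)
  have h1 : ∀ l, ∫ x in unitCube d, a l * expChar (l - k) x = if l = k then a k else 0 := by
    intro l
    rw [integral_const_mul, integral_unitCube_expChar]
    by_cases hl : l = k <;> simp [hl, sub_eq_zero]
  simp_rw [h1] at h
  rw [← h.unique (hasSum_ite_eq k (a k))]
  refine setIntegral_congr_fun measurableSet_unitCube fun x hx => ?_
  refine HasSum.tsum_eq ?_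
  refine ((hF x hx).mul_right (expChar (-k) x)).congr_fun fun l => ?_
  simp only [sub_eq_add_neg, expChar_add]; ring

section Tent

variable {d : ℕ}

/-- The Fourier series of the second Bernoulli function, composed with a dilation. -/
lemma hasAbsConvFourier_of_eq_bernoulliFun (j : Fin d) (m : ℤ) (P : ℝ → ℝ)
    (hP : ∀ t ∈ Ioo (0 : ℝ) 1, ∃ s ∈ Icc (0 : ℝ) 1,
      ((m * t : ℝ) : UnitAddCircle) = (s : UnitAddCircle) ∧ P t = bernoulliFun 2 s) :
    HasAbsConvFourier (fun x : Ed d => (P (x j) : ℂ)) := by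
  have hc : (-(2 * π * Complex.I) ^ 2 / (Nat.factorial 2 : ℂ)) ≠ 0 := by
    simp [Real.pi_ne_zero]
  refine ⟨ℤ, fun n => (-(2 * π * Complex.I) ^ 2 / (Nat.factorial 2 : ℂ))⁻¹ * (1 / (n : ℂ) ^ 2),
    fun n => Pi.single j (n * m), ?_, fun x hx => ?_⟩
  · simp_rw [norm_mul]
    refine Summable.mul_left _ ?_
    simpa using (Real.summable_one_div_int_pow (p := 2)).2 one_lt_two
  · obtain ⟨s, hs, hst, hPs⟩ := hP (x j) (hx j)
    have h := (hasSum_one_div_pow_mul_fourier_mul_bernoulliFun le_rfl hs).mul_left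
      (-(2 * π * Complex.I) ^ 2 / (Nat.factorial 2 : ℂ))⁻¹
    rw [inv_mul_cancel_left₀ hc, ← hPs] at h
    refine h.congr_fun fun n => ?_
    rw [expChar_single, ← hst, mul_assoc]
    congr 2
    rw [fourier_coe_apply, fourier_coe_apply]
    push_cast
    ring_nf

lemma hasAbsConvFourier_one_sub_lamTent (j : Fin d) :
    HasAbsConvFourier (fun x : Ed d => ((1 - lamTent (x j) : ℝ) : ℂ)) := by
  have h1 : HasAbsConvFourier (fun x : Ed d => ((bernoulliFun 2 (x j) : ℝ) : ℂ)) :=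
    hasAbsConvFourier_of_eq_bernoulliFun j 1 _ fun t ht =>
      ⟨t, ⟨ht.1.le, ht.2.le⟩, by simp, rfl⟩
  have h2 : HasAbsConvFourier (fun x : Ed d => ((if x j ≤ 1 / 2 then bernoulliFun 2 (2 * x j)
      else bernoulliFun 2 (2 * x j - 1) : ℝ) : ℂ)) := by
    refine hasAbsConvFourier_of_eq_bernoulliFun j 2
      (fun t => if t ≤ 1 / 2 then bernoulliFun 2 (2 * t) else bernoulliFun 2 (2 * t - 1))
      fun t ht => ?_
    by_cases h : t ≤ 1 / 2
    · exact ⟨2 * t, ⟨by linarith [ht.1], by linarith⟩, by simp, by simp only [if_pos h]⟩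
    · refine ⟨2 * t - 1, ⟨by linarith, by linarith [ht.2]⟩, ?_, by simp only [if_neg h]⟩
      rw [AddCircle.coe_sub, AddCircle.coe_period]
      simp
  refine (((HasAbsConvFourier.const (3 / 4)).add ((HasAbsConvFourier.const 2).mul h1)).add
    ((HasAbsConvFourier.const (-1 / 2)).mul h2)).congr
    fun x hx => ?_
  simp only [bernoulliFun_two, lamTent]
  split_ifs with h
  · rw [abs_of_nonpos (by linarith)]; push_cast; ring
  · rw [abs_of_nonneg (by linarith)]; push_cast; ring

lemma lamTent_mul_one_sub (t : ℝ) : lamTent t * (1 - lamTent t) = t * (1 - t) := by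
  unfold lamTent
  have := sq_abs (t - 1 / 2)
  linear_combination -this

lemma lamTent_pos {t : ℝ} (h0 : 0 < t) (h1 : t < 1) : 0 < lamTent t := by
  unfold lamTent
  have : |t - 1 / 2| < 1 / 2 := abs_lt.2 ⟨by linarith, by linarith⟩
  linarith

end Tent

section Smooth

variable {d : ℕ}

lemma summable_int_norm_inv_pow (d : ℕ) :
    Summable fun k : Fin d → ℤ => ‖(fun i => (k i : ℝ))‖⁻¹ ^ (d + 1) := by
  let L := Submodule.span ℤ (range (Pi.basisFun ℝ (Fin d)))
  have hmem (k : Fin d → ℤ) : (fun i => (k i : ℝ)) ∈ L := by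
    have : (fun i => (k i : ℝ)) = ∑ i, k i • Pi.basisFun ℝ (Fin d) i := by
      ext j; simp [Finset.sum_apply, Pi.single_apply]
    rw [this]
    exact Submodule.sum_mem _ fun i _ => Submodule.smul_mem _ _ (Submodule.subset_span ⟨i, rfl⟩)
  have hrank : Module.finrank ℤ L < d + 1 := by
    rw [ZLattice.rank ℝ]; simp
  have h := (ZLattice.summable_norm_pow_inv L (d + 1) hrank).comp_injective
    (i := fun k : Fin d → ℤ => (⟨_, hmem k⟩ : L)) fun k l hkl => by
      ext i
      simpa using congrFun (congrArg Subtype.val hkl) i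
  exact h

/-- The values of a Schwartz function at the integer points are summable. -/
lemma summable_schwartz_int (f : SchwartzMap (Ed d) ℂ) :
    Summable fun k : Fin d → ℤ => f (WithLp.toLp 2 fun i => (k i : ℝ)) := by
  obtain ⟨C, hC, h⟩ := f.decay (d + 1) 0
  refine Summable.of_norm_bounded_eventually ((summable_int_norm_inv_pow d).mul_left C) ?_
  filter_upwards [(finite_singleton (0 : Fin d → ℤ)).compl_mem_cofinite] with k hk
  have hk0 : (fun i => (k i : ℝ)) ≠ 0 := fun h0 => hk <| by
    ext i; simpa using congrFun h0 i
  have hpos : 0 < ‖(fun i => (k i : ℝ))‖ := norm_pos_iff.2 hk0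
  have hle : ‖(fun i => (k i : ℝ))‖ ≤ ‖(WithLp.toLp 2 fun i => (k i : ℝ) : Ed d)‖ :=
    (pi_norm_le_iff_of_nonneg (norm_nonneg _)).2 fun i =>
      PiLp.norm_apply_le (WithLp.toLp 2 fun i => (k i : ℝ) : Ed d) i
  have := h (WithLp.toLp 2 fun i => (k i : ℝ))
  rw [norm_iteratedFDeriv_zero] at this
  rw [inv_pow, ← div_eq_mul_inv, le_div_iff₀ (by positivity), mul_comm]
  refine le_trans ?_ this
  gcongr

/-- The periodization of a function on the unit cube, as a function on the torus. -/
def periodize (f : Ed d → ℂ) (t : UnitAddTorus (Fin d)) : ℂ :=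
  f (WithLp.toLp 2 fun i => (AddCircle.equivIco 1 0 (t i) : ℝ))

lemma periodize_coe (f : Ed d → ℂ) {x : Ed d} (hx : ∀ i, x i ∈ Ico (0 : ℝ) 1) :
    periodize f (fun i => (x i : UnitAddCircle)) = f x := by
  unfold periodize
  congr 1
  ext i
  have h := AddCircle.coe_equivIco_mk_apply (p := 1) (x i)
  rw [div_one, mul_one, Int.fract_eq_self.2 (hx i)] at h
  exact h

lemma continuous_periodize {f : Ed d → ℂ} (hf : Continuous f) (hc : HasCompactSupport f)
    (hs : tsupport f ⊆ unitCube d) : Continuous (periodize f) := by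
  let p : Ed d → UnitAddTorus (Fin d) := fun x i => (x i : UnitAddCircle)
  have hp : Continuous p := continuous_pi fun i =>
    (AddCircle.continuous_mk' 1).comp (by fun_prop)
  have hclosed : IsClosed (p '' tsupport f) := (hc.isCompact.image hp).isClosed
  rw [continuous_iff_continuousAt]
  intro t
  by_cases ht : t ∈ p '' tsupport f
  · obtain ⟨x, hx, rfl⟩ := ht
    refine hf.continuousAt.comp ?_
    refine (PiLp.continuous_toLp 2 _).continuousAt.comp ?_
    refine continuousAt_pi.2 fun i => ?_
    have hne : (x i : UnitAddCircle) ≠ ((0 : ℝ) : UnitAddCircle) := by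
      intro h
      have hxi := hs hx i
      rw [← sub_eq_zero, ← AddCircle.coe_sub, sub_zero,
        AddCircle.coe_eq_zero_iff_of_mem_Ico (p := 1) ⟨hxi.1.le, hxi.2⟩] at h
      linarith
    exact continuousAt_subtype_val.comp (ContinuousAt.comp
      (f := fun t : UnitAddTorus (Fin d) => t i) (AddCircle.continuousAt_equivIco 1 0 hne)
      (continuous_apply i).continuousAt)
  · have : periodize f =ᶠ[𝓝 t] fun _ => 0 := by
      filter_upwards [hclosed.isOpen_compl.mem_nhds ht] with u hu
      by_contra h
      refine hu ⟨_, subset_tsupport _ h, ?_⟩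
      ext i
      exact (AddCircle.equivIco 1 0).symm_apply_apply (u i)
    exact continuousAt_const.congr this.symm

lemma mFourierCoeff_periodize {f : Ed d → ℂ} (hs : tsupport f ⊆ unitCube d)
    (k : Fin d → ℤ) :
    mFourierCoeff (periodize f) k =
      FourierTransform.fourier f (WithLp.toLp 2 fun i => (k i : ℝ)) := by
  have hz (x : Ed d) (hx : x ∉ unitCube d) : f x = 0 :=
    image_eq_zero_of_notMem_tsupport fun h => hx (hs h)
  rw [mFourierCoeff_eq_integral _ _ 0, Real.fourier_eq',
    ← (PiLp.volume_preserving_ofLp (Fin d)).setIntegral_preimage_emb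
    (MeasurableEquiv.toLp 2 (Fin d → ℝ)).symm.measurableEmbedding]
  refine Eq.trans ?_ (setIntegral_eq_integral_of_forall_compl_eq_zero
    (s := {x : Ed d | ∀ i, x i ∈ Ioc (0 : ℝ) 1}) ?_)
  · have hset : (WithLp.ofLp ⁻¹' {x : Fin d → ℝ | ∀ i, x i ∈ Ioc ((0 : Fin d → ℝ) i)
        ((0 : Fin d → ℝ) i + 1)} : Set (Ed d)) = {x : Ed d | ∀ i, x i ∈ Ioc (0 : ℝ) 1} := by
      ext x; simp
    rw [hset]
    refine setIntegral_congr_fun ?_ fun x hx => ?_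
    · rw [← hset]
      exact (PiLp.volume_preserving_ofLp (Fin d)).measurable
        (MeasurableSet.univ_pi' fun i => measurableSet_Ioc)
    · have hper : periodize f (fun i => (x i : UnitAddCircle)) = f x := by
        by_cases hxc : x ∈ unitCube d
        · exact periodize_coe f fun i => ⟨(hxc i).1.le, (hxc i).2⟩
        · rw [hz x hxc]
          have : ∃ i, x i = 1 := by
            by_contra! h
            exact hxc fun i => ⟨(hx i).1, lt_of_le_of_ne (hx i).2 (h i)⟩
          obtain ⟨i, hi⟩ := this
          refine hz _ fun h => ?_
          have h0 := (h i).1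
          simp [hi, AddCircle.coe_equivIco_mk_apply] at h0
      have hchar := expChar_neg k x
      simp only [hper, mFourier_coe, hchar]
      congr 2
      simp only [PiLp.inner_apply, RCLike.inner_apply, conj_trivial]
      push_cast
      ring
  · intro x hx
    rw [hz x fun h => hx fun i => ⟨(h i).1, (h i).2.le⟩, smul_zero]

lemma hasAbsConvFourier_of_smooth {f : Ed d → ℂ} (hf : ContDiff ℝ (⊤ : ℕ∞) f)
    (hc : HasCompactSupport f) (hs : tsupport f ⊆ unitCube d) : HasAbsConvFourier f := by
  let G : C(UnitAddTorus (Fin d), ℂ) := ⟨periodize f, continuous_periodize hf.continuous hc hs⟩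
  have hsum : Summable (mFourierCoeff G) := by
    have h := summable_schwartz_int (FourierTransform.fourier (hc.toSchwartzMap hf))
    refine h.congr fun k => ?_
    exact (mFourierCoeff_periodize hs k).symm
  refine ⟨Fin d → ℤ, mFourierCoeff G, id, hsum.norm, fun x hx => ?_⟩
  have h := hasSum_mFourier_series_apply_of_summable hsum fun i => (x i : UnitAddCircle)
  simp only [mFourier_coe, smul_eq_mul] at h
  rwa [show G (fun i => (x i : UnitAddCircle)) = f x from
    periodize_coe f fun i => ⟨(hx i).1.le, (hx i).2⟩] at h

end Smooth

section Decomposition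

variable {d : ℕ}

/-- Dividing a test function by a smooth function that does not vanish on its support. -/
lemma contDiff_div_of_ne_zero_on_tsupport {E : Type*} [NormedAddCommGroup E] [NormedSpace ℝ E]
    {g q : E → ℂ} (hg : ContDiff ℝ (⊤ : ℕ∞) g) (hq : ContDiff ℝ (⊤ : ℕ∞) q)
    (h : ∀ x ∈ tsupport g, q x ≠ 0) : ContDiff ℝ (⊤ : ℕ∞) (fun x => g x / q x) := by
  refine contDiff_iff_contDiffAt.2 fun x => ?_
  by_cases hx : x ∈ tsupport g
  · simp_rw [div_eq_mul_inv]
    exact hg.contDiffAt.mul (hq.contDiffAt.inv (h x hx))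
  · refine (contDiffAt_const (c := (0 : ℂ))).congr_of_eventuallyEq ?_
    filter_upwards [notMem_tsupport_iff_eventuallyEq.1 hx] with y hy
    simp [hy]

lemma LamTent_ne_zero {x : Ed d} (hx : x ∈ unitCube d) : (LamTent x : ℂ) ≠ 0 :=
  Complex.ofReal_ne_zero.2 <| Finset.prod_ne_zero_iff.2 fun i _ =>
    (lamTent_pos (hx i).1 (hx i).2).ne'

lemma hasAbsConvFourier_div_LamTent {g : Ed d → ℂ} (hg : IsTestFun (unitCube d) g) :
    HasAbsConvFourier (fun x => g x / (LamTent x : ℂ)) := by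
  obtain ⟨hsmooth, hc, hs⟩ := hg
  let q : Ed d → ℂ := fun x => ∏ i, ((x i * (1 - x i) : ℝ) : ℂ)
  have hq : ContDiff ℝ (⊤ : ℕ∞) q := by
    refine contDiff_prod fun i _ => Complex.ofRealCLM.contDiff.comp ?_
    have hi : ContDiff ℝ (⊤ : ℕ∞) fun x : Ed d => x i := contDiff_piLp_apply 2
    exact hi.mul (contDiff_const.sub hi)
  have hq0 (x : Ed d) (hx : x ∈ unitCube d) : q x ≠ 0 :=
    Finset.prod_ne_zero_iff.2 fun i _ => by
      have := mul_pos (hx i).1 (sub_pos.2 (hx i).2)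
      exact Complex.ofReal_ne_zero.2 this.ne'
  have hsub : tsupport (fun x => g x / q x) ⊆ tsupport g :=
    closure_mono fun x hx h => hx (by simp [h])
  have h1 : HasAbsConvFourier (fun x => g x / q x) :=
    hasAbsConvFourier_of_smooth
      (contDiff_div_of_ne_zero_on_tsupport hsmooth hq fun x hx => hq0 x (hs hx))
      (hc.of_isClosed_subset (isClosed_tsupport _) hsub) (hsub.trans hs)
  refine (h1.mul (HasAbsConvFourier.prod Finset.univ fun j _ =>
    hasAbsConvFourier_one_sub_lamTent j)).congr fun x hx => ?_
  have hqL : q x = (LamTent x : ℂ) * ∏ j, ((1 - lamTent (x j) : ℝ) : ℂ) := by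
    simp only [q, LamTent, Complex.ofReal_prod, ← Finset.prod_mul_distrib, ← Complex.ofReal_mul,
      lamTent_mul_one_sub]
  have := hq0 x hx
  rw [hqL] at this ⊢
  rw [div_mul_eq_mul_div, mul_div_mul_right _ _ (right_ne_zero_of_mul this)]

lemma lamTent_eq_volume {t : ℝ} (h0 : 0 < t) (h1 : t < 1) :
    ∫ _ in Ioo (max 0 (t - 1 / 2)) (min (1 / 2) t), (1 : ℂ) = (lamTent t : ℂ) := by
  have h : min (1 / 2) t - max 0 (t - 1 / 2) = lamTent t := by
    unfold lamTent
    rcases le_total t (1 / 2) with ht | ht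
    · rw [min_eq_right ht, max_eq_left (by linarith), abs_of_nonpos (by linarith)]; ring
    · rw [min_eq_left ht, max_eq_right (by linarith), abs_of_nonneg (by linarith)]
  have hpos := lamTent_pos h0 h1
  rw [setIntegral_const, measureReal_def, Real.volume_Ioo, h, ENNReal.toReal_ofReal hpos.le]
  simp

lemma hFun_eq (k : Fin d → ℤ) (x : Ed d) :
    hFun k x = expChar k x *
      Set.indicator {y : Ed d | ∀ i, 0 < y i ∧ y i < 1 / 2} (fun _ => (1 : ℂ)) x := rfl

/-- The convolution of `a h_k` with `h_k`. -/
lemma integral_hFun_mul_hFun (a : ℂ) (k : Fin d → ℤ) {x : Ed d} (hx : x ∈ unitCube d) :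
    ∫ y, (a * hFun k y) * hFun k (x - y) = a * expChar k x * (LamTent x : ℂ) := by
  let s : Fin d → Set ℝ := fun i => Ioo (max 0 (x i - 1 / 2)) (min (1 / 2) (x i))
  have hmeas : MeasurableSet {y : Ed d | ∀ i, y i ∈ s i} :=
    (PiLp.volume_preserving_ofLp (Fin d)).measurable
      (MeasurableSet.univ_pi' fun i => measurableSet_Ioo)
  have hpt (y : Ed d) : (a * hFun k y) * hFun k (x - y) =
      {y : Ed d | ∀ i, y i ∈ s i}.indicator (fun _ => a * expChar k x) y := by
    have hiff : y ∈ {y : Ed d | ∀ i, y i ∈ s i} ↔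
        y ∈ {y : Ed d | ∀ i, 0 < y i ∧ y i < 1 / 2} ∧
          x - y ∈ {y : Ed d | ∀ i, 0 < y i ∧ y i < 1 / 2} := by
      simp only [s, mem_ofPred_eq, mem_Ioo, max_lt_iff, lt_min_iff, PiLp.sub_apply, ← forall_and]
      refine forall_congr' fun i => ⟨fun h => ?_, fun h => ?_⟩
      · exact ⟨⟨h.1.1, h.2.1⟩, by linarith [h.2.2], by linarith [h.1.2]⟩
      · exact ⟨⟨h.1.1, by linarith [h.2.2]⟩, h.1.2, by linarith [h.2.1]⟩
    have hexp : expChar k x = expChar k y * expChar k (x - y) := by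
      rw [← expChar_add_right, add_sub_cancel]
    simp only [hFun_eq]
    by_cases h : y ∈ {y : Ed d | ∀ i, y i ∈ s i}
    · rw [indicator_of_mem h, indicator_of_mem (hiff.1 h).1, indicator_of_mem (hiff.1 h).2, hexp]
      ring
    · rw [indicator_of_notMem h]
      rcases not_and_or.1 (mt hiff.2 h) with h' | h' <;> rw [indicator_of_notMem h'] <;> ring
  have hbox := setIntegral_box_prod s fun _ _ => (1 : ℂ)
  rw [Finset.prod_congr rfl fun i _ => lamTent_eq_volume (hx i).1 (hx i).2] at hbox
  simp only [Finset.prod_const_one] at hbox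
  calc ∫ y, (a * hFun k y) * hFun k (x - y)
      = ∫ y in {y : Ed d | ∀ i, y i ∈ s i}, (a * expChar k x) * 1 := by
        simp_rw [hpt, mul_one]
        exact integral_indicator hmeas
    _ = a * expChar k x * (LamTent x : ℂ) := by
        rw [integral_const_mul, hbox, LamTent, Complex.ofReal_prod]

lemma eLpNorm_hFun (k : Fin d → ℤ) :
    eLpNorm (hFun k) 2 volume = eLpNorm (hFun (0 : Fin d → ℤ)) 2 volume :=
  eLpNorm_congr_norm_ae (.of_forall fun x => by simp [hFun_eq, norm_expChar])

end Decomposition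

/-- every `g ∈ C_c^∞((0,1)^d)` decomposes as `g = Σ_k g_k * h_k` with
`g_k = a_k h_k`, where `(a_k)` are the (absolutely summable) Fourier coefficients of `g/Λ`;
in particular `Σ_k ‖g_k‖_{L²} ‖h_k‖_{L²} < ∞`. -/
theorem stmt8 {d : ℕ} (g : Ed d → ℂ)
    (hg : IsTestFun {x : Ed d | ∀ i, 0 < x i ∧ x i < 1} g) :
    ∃ a : (Fin d → ℤ) → ℂ,
      Summable (fun k => ‖a k‖) ∧
      (∀ k, a k = ∫ x in {x : Ed d | ∀ i, 0 < x i ∧ x i < 1},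
          (g x / (LamTent x : ℂ)) *
            Complex.exp (-(2 * π * Complex.I) * (∑ i, (k i : ℂ) * (x i : ℂ)))) ∧
      (∀ x : Ed d, (∀ i, 0 < x i ∧ x i < 1) →
        g x = ∑' k : Fin d → ℤ, ∫ y, (a k * hFun k y) * hFun k (x - y)) ∧
      Summable (fun k : Fin d → ℤ =>
        (eLpNorm (fun x => a k * hFun k x) 2 volume).toReal *
          (eLpNorm (hFun k) 2 volume).toReal) := by
  obtain ⟨a, ha, hsum⟩ := (hasAbsConvFourier_div_LamTent hg).exists_coeff
  refine ⟨a, ha, fun k => ?_, fun x hx => ?_, ?_⟩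
  · simpa only [expChar_neg] using! coeff_eq_integral ha hsum k
  · have h := (hsum x hx).mul_right (LamTent x : ℂ)
    rw [div_mul_cancel₀ _ (LamTent_ne_zero hx)] at h
    rw [← h.tsum_eq]
    exact tsum_congr fun k => (integral_hFun_mul_hFun (a k) k hx).symm
  · have h (k : Fin d → ℤ) : eLpNorm (fun x => a k * hFun k x) 2 volume =
        ‖a k‖ₑ * eLpNorm (hFun k) 2 volume := eLpNorm_const_smul (a k) (hFun k) 2 volume
    simp_rw [h, ENNReal.toReal_mul, toReal_enorm, eLpNorm_hFun]
    exact (ha.mul_right _).mul_right _
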